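/- The number of inequivalent ranking patterns of unidimensional unfolding models with generic m-tuples of objects is r_IE(3) = 1 when m = 3, and r_IE(m) = r_0(m)/2 = |ch(M_m)|/(2·m!) when m ≥ 4. -/

import Mathlib

/-- The union of the hyperplanes of the braid arrangement `B_m` in `ℝ^m`:
`x_i = x_j` for `1 ≤ i < j ≤ m`. -/
def braidUnion (m : ℕ) : Set (Fin m → ℝ) :=
  ⋃ i : Fin m, ⋃ j : Fin m, ⋃ _ : i < j, {x | x i = x j}

/-- The union of the hyperplanes of the arrangement `N_m` in `ℝ^m`:
`x_i + x_j = x_k + x_l` for quadruples of distinct indices `(i,j,k,l)` with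
`i < j`, `i < k < l`. -/
def midUnion (m : ℕ) : Set (Fin m → ℝ) :=
  ⋃ i : Fin m, ⋃ j : Fin m, ⋃ k : Fin m, ⋃ l : Fin m,
    ⋃ _ : i < j, ⋃ _ : i < k, ⋃ _ : k < l, ⋃ _ : j ≠ k, ⋃ _ : j ≠ l,
      {x | x i + x j = x k + x l}

/-- The union of the hyperplanes of the mid-hyperplane arrangement
`M_m = B_m ∪ N_m`. -/
def midHyperplaneUnion (m : ℕ) : Set (Fin m → ℝ) :=
  braidUnion m ∪ midUnion m

/-- The chamber `C_0 = {x : x_1 < ⋯ < x_m}` of the braid arrangement. -/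
def C0 (m : ℕ) : Set (Fin m → ℝ) := {x | StrictMono x}

/-- The ranking pattern of the unidimensional unfolding model with objects
`x_1, …, x_m ∈ ℝ`: the set of rankings `(i_1 ⋯ i_m)` (permutations of
`{1,…,m}`, where `σ k = i_k`) such that
`|y - x_{i_1}| < ⋯ < |y - x_{i_m}|` for some `y ∈ ℝ`. -/
def RPUF {m : ℕ} (x : Fin m → ℝ) : Set (Equiv.Perm (Fin m)) :=
  {σ | ∃ y : ℝ, ∀ k l : Fin m, k < l → |y - x (σ k)| < |y - x (σ l)|}

/-- The chambers of an arrangement with union of hyperplanes `U`: the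
connected components of the complement of `U`. -/
def chambersOf {m : ℕ} (U : Set (Fin m → ℝ)) : Set (Set (Fin m → ℝ)) :=
  {C | ∃ y ∈ Uᶜ, C = connectedComponentIn Uᶜ y}

/-- `r_0(m)`: the number of ranking patterns of unidimensional unfolding
models with generic `m`-tuples such that `x_1 < ⋯ < x_m`. -/
noncomputable def r0 (m : ℕ) : ℕ :=
  {R : Set (Equiv.Perm (Fin m)) | ∃ x ∈ C0 m \ midUnion m, R = RPUF x}.ncard

/-- The equivalence class of a ranking pattern `R` under relabeling of the
objects: all patterns `σ·R = {(σ(i_1) ⋯ σ(i_m)) : (i_1 ⋯ i_m) ∈ R}` for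
permutations `σ` of `{1,…,m}`. -/
def patternClass {m : ℕ} (R : Set (Equiv.Perm (Fin m))) :
    Set (Set (Equiv.Perm (Fin m))) :=
  {R' | ∃ σ : Equiv.Perm (Fin m), R' = (fun τ => σ * τ) '' R}

/-- `r_IE(m)`: the number of inequivalent ranking patterns of unidimensional
unfolding models with generic `m`-tuples of objects. -/
noncomputable def rIE (m : ℕ) : ℕ :=
  {P | ∃ x ∈ (midHyperplaneUnion m)ᶜ, P = patternClass (RPUF x)}.ncard

/-- The pairs of two-element index sets, listed as `(i, j, k, l)`, such that the midpoint of
`x i` and `x j` lies to the left of that of `x k` and `x l`. -/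
def midpointOrder {m : ℕ} (x : Fin m → ℝ) : Set (Fin m × Fin m × Fin m × Fin m) :=
  {q | q.1 ≠ q.2.1 ∧ q.2.2.1 ≠ q.2.2.2 ∧ x q.1 + x q.2.1 < x q.2.2.1 + x q.2.2.2}

section

variable {m : ℕ} {x x' : Fin m → ℝ}

theorem mem_midpointOrder {i j k l : Fin m} :
    (i, j, k, l) ∈ midpointOrder x ↔ i ≠ j ∧ k ≠ l ∧ x i + x j < x k + x l := Iff.rfl

theorem midpointOrder_eq_iff : midpointOrder x = midpointOrder x' ↔
    ∀ i j k l, i ≠ j → k ≠ l → (x i + x j < x k + x l ↔ x' i + x' j < x' k + x' l) := by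
  constructor
  · intro h i j k l hij hkl
    have := Set.ext_iff.1 h (i, j, k, l)
    simpa only [mem_midpointOrder, hij, hkl, ne_eq, not_false_eq_true, true_and] using this
  · intro h
    ext ⟨i, j, k, l⟩
    rw [mem_midpointOrder, mem_midpointOrder]
    exact and_congr_right fun hij => and_congr_right fun hkl => h i j k l hij hkl

theorem exists_ne_ne (hm : 3 ≤ m) (i j : Fin m) : ∃ c, c ≠ i ∧ c ≠ j := by
  have : ({i, j} : Finset (Fin m)).card < (Finset.univ : Finset (Fin m)).card := by
    rw [Finset.card_fin]
    exact lt_of_le_of_lt Finset.card_le_two (by omega)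
  obtain ⟨c, -, hc⟩ := Finset.exists_mem_notMem_of_card_lt_card this
  exact ⟨c, by simp_all⟩

theorem lt_iff_lt_of_midpointOrder_eq (hm : 3 ≤ m) (h : midpointOrder x = midpointOrder x')
    (i j : Fin m) : x i < x j ↔ x' i < x' j := by
  obtain ⟨c, hi, hj⟩ := exists_ne_ne hm i j
  simpa using midpointOrder_eq_iff.1 h c i c j hi hj

theorem midpointOrder_comp_perm (h : midpointOrder x = midpointOrder x')
    (σ : Equiv.Perm (Fin m)) : midpointOrder (x ∘ σ) = midpointOrder (x' ∘ σ) := by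
  rw [midpointOrder_eq_iff] at h ⊢
  intro i j k l hij hkl
  exact h _ _ _ _ (σ.injective.ne hij) (σ.injective.ne hkl)

/-! ### Generic tuples -/

theorem notMem_midUnion_iff : x ∉ midUnion m ↔ ∀ i j k l, i ≠ j → k ≠ l → i ≠ k → i ≠ l →
    j ≠ k → j ≠ l → x i + x j ≠ x k + x l := by
  simp only [midUnion, Set.mem_iUnion, Set.mem_ofPred_eq, not_exists]
  constructor
  · intro h
    have h1 : ∀ i j k l, i < j → k < l → i ≠ k → i ≠ l → j ≠ k → j ≠ l →
        x i + x j ≠ x k + x l := by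
      intro i j k l hij hkl hik hil hjk hjl e
      rcases lt_or_gt_of_ne hik with h' | h'
      · exact h i j k l hij h' hkl hjk hjl e
      · exact h k l i j hkl h' hij hil.symm hjl.symm e.symm
    intro i j k l hij hkl hik hil hjk hjl e
    rcases lt_or_gt_of_ne hij with a | a <;> rcases lt_or_gt_of_ne hkl with b | b
    · exact h1 i j k l a b hik hil hjk hjl e
    · exact h1 i j l k a b hil hik hjl hjk (by linarith)
    · exact h1 j i k l a b hjk hjl hik hil (by linarith)
    · exact h1 j i l k a b hjl hjk hil hik (by linarith)
  · intro h i j k l hij hik hkl hjk hjl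
    exact h i j k l hij.ne hkl.ne hik.ne (hik.trans hkl).ne hjk hjl

theorem notMem_braidUnion_iff : x ∉ braidUnion m ↔ Function.Injective x := by
  simp only [braidUnion, Set.mem_iUnion, Set.mem_ofPred_eq, not_exists]
  constructor
  · intro h i j e
    by_contra hij
    rcases lt_or_gt_of_ne hij with a | a
    · exact h _ _ a e
    · exact h _ _ a e.symm
  · intro h i j hij e
    exact hij.ne (h e)

theorem mem_generic_iff : x ∈ (midHyperplaneUnion m)ᶜ ↔
    Function.Injective x ∧ x ∉ midUnion m := by
  rw [midHyperplaneUnion, Set.mem_compl_iff, Set.mem_union, not_or, notMem_braidUnion_iff]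

theorem mem_C0_diff_iff : x ∈ C0 m \ midUnion m ↔
    StrictMono x ∧ x ∈ (midHyperplaneUnion m)ᶜ := by
  rw [mem_generic_iff]
  exact ⟨fun h => ⟨h.1, h.1.injective, h.2⟩, fun h => ⟨h.1, h.2.2⟩⟩

theorem mem_generic_of_ne (hx : Function.Injective x)
    (h : ∀ i j k l, i ≠ j → k ≠ l → i ≠ k → i ≠ l → j ≠ k → j ≠ l → x i + x j ≠ x k + x l) :
    x ∈ (midHyperplaneUnion m)ᶜ :=
  mem_generic_iff.2 ⟨hx, notMem_midUnion_iff.2 h⟩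

theorem eq_or_eq_of_mem_generic (hx : x ∈ (midHyperplaneUnion m)ᶜ) {i j k l : Fin m}
    (hij : i ≠ j) (hkl : k ≠ l) (e : x i + x j = x k + x l) :
    (i = k ∧ j = l) ∨ (i = l ∧ j = k) := by
  rw [mem_generic_iff, notMem_midUnion_iff] at hx
  obtain ⟨hinj, hx⟩ := hx
  by_cases hik : i = k
  · subst hik
    exact .inl ⟨rfl, hinj (by linarith)⟩
  by_cases hil : i = l
  · subst hil
    exact .inr ⟨rfl, hinj (by linarith)⟩
  by_cases hjk : j = k
  · subst hjk
    exact .inr ⟨hinj (by linarith), rfl⟩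
  by_cases hjl : j = l
  · subst hjl
    exact .inl ⟨hinj (by linarith), rfl⟩
  exact absurd e (hx i j k l hij hkl hik hil hjk hjl)

theorem generic_comp_perm (hx : x ∈ (midHyperplaneUnion m)ᶜ) (σ : Equiv.Perm (Fin m)) :
    x ∘ σ ∈ (midHyperplaneUnion m)ᶜ := by
  rw [mem_generic_iff, notMem_midUnion_iff] at hx
  refine mem_generic_of_ne (hx.1.comp σ.injective) fun i j k l h1 h2 h3 h4 h5 h6 => ?_
  have := σ.injective
  exact hx.2 _ _ _ _ (this.ne h1) (this.ne h2) (this.ne h3) (this.ne h4) (this.ne h5)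
    (this.ne h6)

theorem generic_neg (hx : x ∈ (midHyperplaneUnion m)ᶜ) : -x ∈ (midHyperplaneUnion m)ᶜ := by
  rw [mem_generic_iff, notMem_midUnion_iff] at hx
  refine mem_generic_of_ne (neg_injective.comp hx.1) fun i j k l h1 h2 h3 h4 h5 h6 e => ?_
  simp only [Pi.neg_apply] at e
  exact hx.2 i j k l h1 h2 h3 h4 h5 h6 (by linarith)

theorem exists_strictMono_comp_perm (hx : Function.Injective x) :
    ∃ σ : Equiv.Perm (Fin m), StrictMono (x ∘ σ) :=
  ⟨Tuple.sort x, (Tuple.monotone_sort x).strictMono_of_injective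
    (hx.comp (Tuple.sort x).injective)⟩

/-! ### Ranking patterns and midpoint orders -/

theorem abs_sub_lt_abs_sub_iff_of_lt {a b y : ℝ} (h : a < b) :
    |y - a| < |y - b| ↔ 2 * y < a + b := by
  rw [← sq_lt_sq]
  constructor <;> intro h' <;> nlinarith

theorem abs_sub_lt_abs_sub_iff_of_gt {a b y : ℝ} (h : b < a) :
    |y - a| < |y - b| ↔ a + b < 2 * y := by
  rw [← sq_lt_sq]
  constructor <;> intro h' <;> nlinarith

theorem mem_RPUF_iff (hx : Function.Injective x) (σ : Equiv.Perm (Fin m)) :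
    σ ∈ RPUF x ↔ ∀ k l k' l' : Fin m, k < l → k' < l' → x (σ l) < x (σ k) →
      x (σ k') < x (σ l') → x (σ k) + x (σ l) < x (σ k') + x (σ l') := by
  constructor
  · rintro ⟨y, hy⟩ k l k' l' hkl hkl' h h'
    have h1 := (abs_sub_lt_abs_sub_iff_of_gt h).1 (hy k l hkl)
    have h2 := (abs_sub_lt_abs_sub_iff_of_lt h').1 (hy k' l' hkl')
    linarith
  · intro H
    classical
    let mid : Fin m × Fin m → ℝ := fun p => x (σ p.1) + x (σ p.2)
    obtain ⟨y, hlo, hhi⟩ := Order.exists_between_finsets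
      ((Finset.univ.filter fun p : Fin m × Fin m =>
        p.1 < p.2 ∧ x (σ p.2) < x (σ p.1)).image mid)
      ((Finset.univ.filter fun p : Fin m × Fin m =>
        p.1 < p.2 ∧ x (σ p.1) < x (σ p.2)).image mid) (by
        simp only [Finset.mem_image, Finset.mem_filter, Finset.mem_univ, true_and]
        rintro _ ⟨p, ⟨hp, hp'⟩, rfl⟩ _ ⟨q, ⟨hq, hq'⟩, rfl⟩
        exact H _ _ _ _ hp hq hp' hq')
    refine ⟨y / 2, fun k l hkl => ?_⟩
    rcases lt_or_gt_of_ne (hx.ne (σ.injective.ne hkl.ne)) with h | h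
    · rw [abs_sub_lt_abs_sub_iff_of_lt h]
      have := hhi (mid (k, l)) (Finset.mem_image_of_mem _ (by simp [hkl, h]))
      simp only [mid] at this
      linarith
    · rw [abs_sub_lt_abs_sub_iff_of_gt h]
      have := hlo (mid (k, l)) (Finset.mem_image_of_mem _ (by simp [hkl, h]))
      simp only [mid] at this
      linarith

theorem RPUF_eq_of_midpointOrder_eq (hm : 3 ≤ m) (hx : Function.Injective x)
    (hx' : Function.Injective x') (h : midpointOrder x = midpointOrder x') :
    RPUF x = RPUF x' := by
  ext σ
  rw [mem_RPUF_iff hx, mem_RPUF_iff hx']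
  refine forall₄_congr fun k l k' l' => imp_congr_right fun hkl => imp_congr_right fun hkl' => ?_
  rw [lt_iff_lt_of_midpointOrder_eq hm h, lt_iff_lt_of_midpointOrder_eq hm h,
    midpointOrder_eq_iff.1 h _ _ _ _ (σ.injective.ne hkl.ne) (σ.injective.ne hkl'.ne)]

theorem exists_symm_lt_iff_of_mem_RPUF {σ : Equiv.Perm (Fin m)} (h : σ ∈ RPUF x) :
    ∃ y : ℝ, ∀ i j, σ.symm i < σ.symm j ↔ |y - x i| < |y - x j| := by
  obtain ⟨y, hy⟩ := h
  have hmono : StrictMono fun k => |y - x (σ k)| := fun k l hkl => hy k l hkl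
  refine ⟨y, fun i j => ?_⟩
  simpa using (hmono.lt_iff_lt (a := σ.symm i) (b := σ.symm j)).symm

theorem exists_mem_RPUF_of_lt (hx : Function.Injective x) {a b : ℝ} (hab : a < b) :
    ∃ y ∈ Set.Ioo a b, ∃ σ ∈ RPUF x, ∀ i j, σ.symm i < σ.symm j ↔ |y - x i| < |y - x j| := by
  obtain ⟨y, hy, hne⟩ := (Set.Ioo_infinite hab).exists_notMem_finset
    (Finset.univ.image fun p : Fin m × Fin m => (x p.1 + x p.2) / 2)
  have hinj : Function.Injective fun i => |y - x i| := by
    intro i j e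
    by_contra hij
    rcases abs_eq_abs.1 e with e | e
    · exact hij (hx (by linarith))
    · exact hne (Finset.mem_image.2 ⟨(i, j), Finset.mem_univ _, by simp only; linarith⟩)
  obtain ⟨σ, hσ⟩ := exists_strictMono_comp_perm hinj
  refine ⟨y, hy, σ, ⟨y, fun k l hkl => hσ hkl⟩, fun i j => ?_⟩
  simpa using (hσ.lt_iff_lt (a := σ.symm i) (b := σ.symm j)).symm

theorem add_lt_add_of_RPUF_subset (hx : StrictMono x) (hx' : StrictMono x')
    (h : RPUF x ⊆ RPUF x') {i j k l : Fin m} (hij : i < j) (hkl : k < l)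
    (hlt : x i + x j < x k + x l) : x' i + x' j < x' k + x' l := by
  obtain ⟨y, ⟨h1, h2⟩, σ, hσ, H⟩ := exists_mem_RPUF_of_lt hx.injective
    (show (x i + x j) / 2 < (x k + x l) / 2 by linarith)
  obtain ⟨y', H'⟩ := exists_symm_lt_iff_of_mem_RPUF (h hσ)
  have hji := (H' j i).1 ((H j i).2 ((abs_sub_lt_abs_sub_iff_of_gt (hx hij)).2 (by linarith)))
  have hkl' := (H' k l).1 ((H k l).2 ((abs_sub_lt_abs_sub_iff_of_lt (hx hkl)).2 (by linarith)))
  rw [abs_sub_lt_abs_sub_iff_of_gt (hx' hij)] at hji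
  rw [abs_sub_lt_abs_sub_iff_of_lt (hx' hkl)] at hkl'
  linarith

theorem midpointOrder_subset_of_RPUF_subset (hx : StrictMono x) (hx' : StrictMono x')
    (h : RPUF x ⊆ RPUF x') : midpointOrder x ⊆ midpointOrder x' := by
  rintro ⟨i, j, k, l⟩ ⟨hij, hkl, hlt⟩
  refine ⟨hij, hkl, ?_⟩
  dsimp only at hij hkl hlt ⊢
  rcases lt_or_gt_of_ne hij with a | a <;> rcases lt_or_gt_of_ne hkl with b | b
  · exact add_lt_add_of_RPUF_subset hx hx' h a b hlt
  · rw [add_comm (x' k)]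
    exact add_lt_add_of_RPUF_subset hx hx' h a b (by linarith)
  · rw [add_comm (x' i)]
    exact add_lt_add_of_RPUF_subset hx hx' h a b (by linarith)
  · rw [add_comm (x' i), add_comm (x' k)]
    exact add_lt_add_of_RPUF_subset hx hx' h a b (by linarith)

theorem RPUF_eq_iff (hm : 3 ≤ m) (hx : StrictMono x) (hx' : StrictMono x') :
    RPUF x = RPUF x' ↔ midpointOrder x = midpointOrder x' :=
  ⟨fun h => (midpointOrder_subset_of_RPUF_subset hx hx' h.subset).antisymm
    (midpointOrder_subset_of_RPUF_subset hx' hx h.superset),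
    RPUF_eq_of_midpointOrder_eq hm hx.injective hx'.injective⟩

/-! ### Relabeling and reflection -/

theorem image_mul_RPUF_comp (x : Fin m → ℝ) (σ : Equiv.Perm (Fin m)) :
    (fun τ => σ * τ) '' RPUF (x ∘ σ) = RPUF x := by
  ext τ
  constructor
  · rintro ⟨τ, ⟨y, hy⟩, rfl⟩
    exact ⟨y, hy⟩
  · rintro ⟨y, hy⟩
    exact ⟨σ⁻¹ * τ, ⟨y, fun k l hkl => by simpa using hy k l hkl⟩, by simp⟩

theorem RPUF_neg (x : Fin m → ℝ) : RPUF (-x) = RPUF x := by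
  have key : ∀ z : Fin m → ℝ, RPUF z ⊆ RPUF (-z) := by
    rintro z σ ⟨y, hy⟩
    refine ⟨-y, fun k l hkl => ?_⟩
    have := hy k l hkl
    rwa [Pi.neg_apply, Pi.neg_apply, neg_sub_neg, neg_sub_neg, abs_sub_comm (z (σ k)),
      abs_sub_comm (z (σ l))]
  exact (by simpa using key (-x) : RPUF (-x) ⊆ RPUF x).antisymm (key x)

theorem monotone_or_antitone_of_RPUF_subset (hx : Function.Injective x) (hx' : StrictMono x')
    (h : RPUF x ⊆ RPUF x') : Monotone x ∨ Antitone x := by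
  have key : ∀ z : Fin m → ℝ, Function.Injective z → RPUF z ⊆ RPUF x' → ∀ a b c : Fin m,
      a < b → b < c → z a < z b → z c < z b → False := by
    intro z hz hsub a b c hab hbc ha hc
    obtain ⟨y, ⟨-, hy⟩, σ, hσ, H⟩ := exists_mem_RPUF_of_lt hz
      (sub_one_lt (min ((z a + z b) / 2) ((z c + z b) / 2)))
    obtain ⟨h1, h2⟩ := lt_min_iff.1 hy
    obtain ⟨y', H'⟩ := exists_symm_lt_iff_of_mem_RPUF (hsub hσ)
    have hab' := (H' a b).1 ((H a b).2 ((abs_sub_lt_abs_sub_iff_of_lt ha).2 (by linarith)))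
    have hcb' := (H' c b).1 ((H c b).2 ((abs_sub_lt_abs_sub_iff_of_lt hc).2 (by linarith)))
    rw [abs_sub_lt_abs_sub_iff_of_lt (hx' hab)] at hab'
    rw [abs_sub_lt_abs_sub_iff_of_gt (hx' hbc)] at hcb'
    linarith [hx' hab, hx' hbc]
  by_contra hcon
  rw [not_or, not_monotone_not_antitone_iff_exists_lt_lt] at hcon
  obtain ⟨a, b, c, hab, hbc, ⟨ha, hc⟩ | ⟨ha, hc⟩⟩ := hcon
  · exact key x hx h a b c hab hbc ha hc
  · exact key (-x) (neg_injective.comp hx) (by rwa [RPUF_neg]) a b c hab hbc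
      (neg_lt_neg ha) (neg_lt_neg hc)

theorem perm_eq_of_strictMono_comp {σ τ : Equiv.Perm (Fin m)} (hx : StrictMono x)
    (h : StrictMono (x ∘ σ ∘ τ.symm)) : σ = τ := by
  have hmono : StrictMono (τ.symm.trans σ) := fun i j hij => hx.lt_iff_lt.1 (h hij)
  have := (hmono.range_inj strictMono_id).1 (by simp [EquivLike.range_eq_univ])
  ext i
  simpa using congrArg Fin.val (congrFun this (τ i))

/-- The reflected tuple, again increasing if `x` is. -/
def reflectTuple (x : Fin m → ℝ) : Fin m → ℝ := -(x ∘ Fin.revPerm)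

theorem reflectTuple_mem (hx : x ∈ C0 m \ midUnion m) :
    reflectTuple x ∈ C0 m \ midUnion m := by
  rw [mem_C0_diff_iff] at hx ⊢
  refine ⟨fun i j hij => neg_lt_neg (hx.1 (Fin.rev_lt_rev.2 hij)), ?_⟩
  exact generic_neg (generic_comp_perm hx.2 _)

theorem image_mul_RPUF_reflectTuple (x : Fin m → ℝ) :
    (fun τ => Fin.revPerm * τ) '' RPUF (reflectTuple x) = RPUF x := by
  rw [reflectTuple, RPUF_neg, image_mul_RPUF_comp]

theorem RPUF_reflectTuple_ne (hm : 4 ≤ m) (hx : x ∈ C0 m \ midUnion m) :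
    RPUF (reflectTuple x) ≠ RPUF x := by
  intro h
  have hgen := (mem_C0_diff_iff.1 hx).2
  rw [RPUF_eq_iff (by omega) (reflectTuple_mem hx).1 hx.1, midpointOrder_eq_iff] at h
  let a : Fin m := ⟨0, by omega⟩
  let b : Fin m := ⟨1, by omega⟩
  have hab : a ≠ b := by simp [a, b]
  have har : a ≠ a.rev := by simp [a, Fin.ext_iff]; omega
  have hbr : b ≠ b.rev := by simp [b, Fin.ext_iff]; omega
  have hne : x a + x a.rev ≠ x b + x b.rev := by
    intro e
    rcases eq_or_eq_of_mem_generic hgen har hbr e with ⟨e, -⟩ | ⟨e, -⟩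
    · exact hab e
    · simp [a, b, Fin.ext_iff] at e
      omega
  have h1 := h a a.rev b b.rev har hbr
  have h2 := h b b.rev a a.rev hbr har
  simp only [reflectTuple, Pi.neg_apply, Function.comp_apply, Fin.revPerm_apply,
    Fin.rev_rev] at h1 h2
  rcases lt_or_gt_of_ne hne with e | e
  · linarith [h1.2 e]
  · linarith [h2.2 e]

theorem eq_or_eq_reflectTuple (hx : x ∈ C0 m \ midUnion m) (hx' : x' ∈ C0 m \ midUnion m)
    {σ : Equiv.Perm (Fin m)} (h : RPUF x' = (fun τ => σ * τ) '' RPUF x) :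
    RPUF x' = RPUF x ∨ RPUF x' = RPUF (reflectTuple x) := by
  have hz : RPUF (x ∘ σ.symm) = RPUF x' := by
    rw [h, ← image_mul_RPUF_comp (x ∘ σ.symm) σ]
    simp [Function.comp_assoc]
  have hinj : Function.Injective (x ∘ σ.symm) := hx.1.injective.comp σ.symm.injective
  rcases monotone_or_antitone_of_RPUF_subset hinj hx'.1 hz.subset with hmon | hanti
  · have : 1 = σ := perm_eq_of_strictMono_comp hx.1 (hmon.strictMono_of_injective hinj)
    subst this
    exact .inl hz.symm
  · right
    have hrev : (Fin.revPerm : Equiv.Perm (Fin m)) = σ := by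
      refine perm_eq_of_strictMono_comp (reflectTuple_mem hx).1 ?_
      intro i j hij
      simpa [reflectTuple] using hanti.strictAnti_of_injective hinj hij
    subst hrev
    rw [← hz, reflectTuple, RPUF_neg]
    rfl

theorem patternClass_eq_iff {R R' : Set (Equiv.Perm (Fin m))} :
    patternClass R = patternClass R' ↔ ∃ σ : Equiv.Perm (Fin m), R' = (fun τ => σ * τ) '' R := by
  constructor
  · intro h
    have : R' ∈ patternClass R' := ⟨1, by simp⟩
    rwa [← h] at this
  · rintro ⟨σ, rfl⟩
    ext S
    constructor
    · rintro ⟨ρ, rfl⟩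
      exact ⟨ρ * σ⁻¹, by simp [Set.image_image, mul_assoc]⟩
    · rintro ⟨ρ, rfl⟩
      exact ⟨ρ * σ, by simp only [Set.image_image, mul_assoc]⟩

theorem patternClass_RPUF_comp (x : Fin m → ℝ) (σ : Equiv.Perm (Fin m)) :
    patternClass (RPUF (x ∘ σ)) = patternClass (RPUF x) :=
  patternClass_eq_iff.2 ⟨σ, (image_mul_RPUF_comp x σ).symm⟩

theorem rIE_eq_ncard_image :
    rIE m = (patternClass '' (RPUF '' (C0 m \ midUnion m))).ncard := by
  unfold rIE
  congr 1
  ext P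
  rw [Set.image_image]
  constructor
  · rintro ⟨x, hx, rfl⟩
    obtain ⟨σ, hσ⟩ := exists_strictMono_comp_perm (mem_generic_iff.1 hx).1
    exact ⟨x ∘ σ, mem_C0_diff_iff.2 ⟨hσ, generic_comp_perm hx σ⟩, patternClass_RPUF_comp x σ⟩
  · rintro ⟨x, hx, rfl⟩
    exact ⟨x, (mem_C0_diff_iff.1 hx).2, rfl⟩

theorem r0_eq_ncard_image : r0 m = (RPUF '' (C0 m \ midUnion m)).ncard := by
  unfold r0
  congr 1
  ext R
  exact exists_congr fun x => and_congr_right fun _ => eq_comm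

theorem Set.ncard_eq_mul_ncard_image {α β : Type*} {s : Set α} (hs : s.Finite) (f : α → β) (n : ℕ)
    (h : ∀ a ∈ s, {b ∈ s | f b = f a}.ncard = n) : s.ncard = n * (f '' s).ncard := by
  classical
  lift s to Finset α using hs
  rw [← Finset.coe_image, Set.ncard_coe_finset, Set.ncard_coe_finset,
    Finset.card_eq_sum_card_image f, mul_comm]
  refine Finset.sum_const_nat fun b hb => ?_
  obtain ⟨a, ha, rfl⟩ := Finset.mem_image.1 hb
  rw [← h a ha, ← Set.ncard_coe_finset]
  simp

theorem r0_eq_two_mul_rIE (hm : 4 ≤ m) : r0 m = 2 * rIE m := by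
  rw [rIE_eq_ncard_image, r0_eq_ncard_image]
  refine Set.ncard_eq_mul_ncard_image (Set.toFinite _) _ _ ?_
  rintro _ ⟨x, hx, rfl⟩
  rw [← Set.ncard_pair (RPUF_reflectTuple_ne hm hx)]
  congr 1
  ext R
  constructor
  · rintro ⟨⟨x', hx', rfl⟩, h⟩
    obtain ⟨σ, hσ⟩ := patternClass_eq_iff.1 h.symm
    exact (eq_or_eq_reflectTuple hx hx' hσ).symm
  · rintro (rfl | rfl)
    · refine ⟨⟨_, reflectTuple_mem hx, rfl⟩, patternClass_eq_iff.2 ⟨Fin.revPerm, ?_⟩⟩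
      exact (image_mul_RPUF_reflectTuple x).symm
    · exact ⟨⟨x, hx, rfl⟩, rfl⟩

theorem rIE_three : rIE 3 = 1 := by
  rw [rIE_eq_ncard_image, Set.ncard_eq_one]
  have hex : (fun i : Fin 3 => (i : ℝ)) ∈ C0 3 \ midUnion 3 := by
    refine ⟨fun i j hij => by simpa using hij, notMem_midUnion_iff.2 fun i j k l => ?_⟩
    omega
  have hRP : ∀ x ∈ C0 3 \ midUnion 3, RPUF x = RPUF fun i : Fin 3 => (i : ℝ) := by
    intro x hx
    rw [RPUF_eq_iff le_rfl hx.1 hex.1, midpointOrder_eq_iff]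
    intro i j k l hij hkl
    have hlt : ∀ a b, x a < x b ↔ ((a : ℕ) : ℝ) < (b : ℕ) := fun a b => by
      rw [StrictMono.lt_iff_lt hx.1, ← StrictMono.lt_iff_lt hex.1]
    have : i = k ∨ i = l ∨ j = k ∨ j = l := by omega
    rcases this with rfl | rfl | rfl | rfl
    · simpa using hlt j l
    · simpa [add_comm] using hlt j k
    · rw [add_comm (x j), add_comm ((j : ℕ) : ℝ)]
      simpa using hlt i l
    · simpa using hlt i k
  refine ⟨patternClass (RPUF fun i : Fin 3 => (i : ℝ)), ?_⟩
  rw [Set.eq_singleton_iff_unique_mem]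
  refine ⟨⟨_, ⟨_, hex, rfl⟩, rfl⟩, ?_⟩
  rintro _ ⟨_, ⟨x, hx, rfl⟩, rfl⟩
  rw [hRP x hx]

/-! ### Chambers of the mid-hyperplane arrangement -/

theorem connectedComponentIn_eq_of_midpointOrder_eq (hm : 3 ≤ m)
    (hx : x ∈ (midHyperplaneUnion m)ᶜ) (h : midpointOrder x = midpointOrder x') :
    connectedComponentIn (midHyperplaneUnion m)ᶜ x =
      connectedComponentIn (midHyperplaneUnion m)ᶜ x' := by
  let K : Set (Fin m → ℝ) :=
    {z | ∀ i j k l, (i, j, k, l) ∈ midpointOrder x → z i + z j < z k + z l}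
  have hconv : Convex ℝ K := by
    intro u hu v hv a b ha hb hab i j k l hq
    have h1 := hu i j k l hq
    have h2 := hv i j k l hq
    simp only [Pi.add_apply, Pi.smul_apply, smul_eq_mul]
    have ha1 : a = 1 - b := by linarith
    subst ha1
    rcases hb.eq_or_lt with rfl | hb'
    · simpa using h1
    · nlinarith [mul_lt_mul_of_pos_left h2 hb', mul_le_mul_of_nonneg_left h1.le ha]
  have hsub : K ⊆ (midHyperplaneUnion m)ᶜ := by
    intro z hz
    have hdis : ∀ i j k l, i ≠ j → k ≠ l → x i + x j ≠ x k + x l → z i + z j ≠ z k + z l := by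
      intro i j k l hij hkl hne
      rcases lt_or_gt_of_ne hne with e | e
      · exact (hz i j k l ⟨hij, hkl, e⟩).ne
      · exact (hz k l i j ⟨hkl, hij, e⟩).ne'
    rw [mem_generic_iff, notMem_midUnion_iff] at hx
    refine mem_generic_of_ne ?_ fun i j k l h1 h2 h3 h4 h5 h6 =>
      hdis i j k l h1 h2 (hx.2 i j k l h1 h2 h3 h4 h5 h6)
    intro i j e
    by_contra hij
    obtain ⟨c, hi, hj⟩ := exists_ne_ne hm i j
    exact hdis c i c j hi hj (by simpa using hx.1.ne hij) (by rw [e])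
  have hxK : x ∈ K := fun i j k l hq => hq.2.2
  have hxK' : x' ∈ K := fun i j k l hq => (h ▸ hq : _ ∈ midpointOrder x').2.2
  exact connectedComponentIn_eq
    (hconv.isPreconnected.subset_connectedComponentIn hxK hsub hxK')

theorem midpointOrder_subset_of_mem_connectedComponentIn
    {S : Set (Fin m → ℝ)} (hS : IsPreconnected S) (hsub : S ⊆ (midHyperplaneUnion m)ᶜ)
    (hx : x ∈ S) (hx' : x' ∈ S) : midpointOrder x ⊆ midpointOrder x' := by
  rintro ⟨i, j, k, l⟩ ⟨hij, hkl, hlt⟩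
  refine ⟨hij, hkl, ?_⟩
  dsimp only at hij hkl hlt ⊢
  by_contra! hle
  let f : (Fin m → ℝ) → ℝ := fun z => z k + z l - (z i + z j)
  obtain ⟨z, hz, hz0⟩ := hS.intermediate_value hx' hx
    (f := f) (by fun_prop) (show (0 : ℝ) ∈ Set.Icc (f x') (f x) by
      constructor <;> simp only [f] <;> linarith)
  rcases eq_or_eq_of_mem_generic (hsub hz) hij hkl (by simp only [f] at hz0; linarith) with
    ⟨rfl, rfl⟩ | ⟨rfl, rfl⟩ <;> linarith

theorem connectedComponentIn_eq_iff (hm : 3 ≤ m) (hx : x ∈ (midHyperplaneUnion m)ᶜ)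
    (hx' : x' ∈ (midHyperplaneUnion m)ᶜ) :
    connectedComponentIn (midHyperplaneUnion m)ᶜ x =
      connectedComponentIn (midHyperplaneUnion m)ᶜ x' ↔ midpointOrder x = midpointOrder x' := by
  refine ⟨fun h => ?_, connectedComponentIn_eq_of_midpointOrder_eq hm hx⟩
  have h1 := mem_connectedComponentIn hx
  have h2 := mem_connectedComponentIn hx'
  rw [← h] at h2
  have key {u v : Fin m → ℝ} := midpointOrder_subset_of_mem_connectedComponentIn (x := u) (x' := v)
    isPreconnected_connectedComponentIn (connectedComponentIn_subset (midHyperplaneUnion m)ᶜ x)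
  exact (key h1 h2).antisymm (key h2 h1)

theorem Set.ncard_image_eq_ncard_image {α β γ : Type*} {s : Set α} {f : α → β} {g : α → γ}
    (h : ∀ a ∈ s, ∀ b ∈ s, f a = f b ↔ g a = g b) : (f '' s).ncard = (g '' s).ncard := by
  rcases s.eq_empty_or_nonempty with rfl | ⟨a₀, -⟩
  · simp
  have : Nonempty α := ⟨a₀⟩
  have hinv : ∀ a ∈ s, g (Function.invFunOn f s (f a)) = g a := fun a ha =>
    (h _ (Function.invFunOn_mem ⟨a, ha, rfl⟩) _ ha).1 (Function.invFunOn_eq ⟨a, ha, rfl⟩)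
  have himage : (g ∘ Function.invFunOn f s) '' (f '' s) = g '' s := by
    rw [Set.image_image]
    exact Set.image_congr hinv
  rw [← himage]
  refine (Set.InjOn.ncard_image ?_).symm
  rintro _ ⟨a, ha, rfl⟩ _ ⟨b, hb, rfl⟩ e
  rw [Function.comp_apply, Function.comp_apply, hinv a ha, hinv b hb] at e
  exact (h a ha b hb).2 e

theorem midpointOrder_comp_eq_iff (hm : 3 ≤ m) (hx : StrictMono x) (hx' : StrictMono x')
    (σ τ : Equiv.Perm (Fin m)) : midpointOrder (x ∘ σ) = midpointOrder (x' ∘ τ) ↔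
      σ = τ ∧ midpointOrder x = midpointOrder x' := by
  constructor
  · intro h
    have hστ : σ = τ := by
      refine perm_eq_of_strictMono_comp hx fun i j hij => ?_
      have := lt_iff_lt_of_midpointOrder_eq hm h (τ.symm i) (τ.symm j)
      simp only [Function.comp_apply, Equiv.apply_symm_apply] at this
      exact this.2 (hx' hij)
    subst hστ
    refine ⟨rfl, ?_⟩
    simpa [Function.comp_assoc] using midpointOrder_comp_perm h σ.symm
  · rintro ⟨rfl, h⟩
    exact midpointOrder_comp_perm h σ

theorem ncard_chambersOf (hm : 3 ≤ m) :
    (chambersOf (midHyperplaneUnion m)).ncard = m.factorial * r0 m := by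
  have h1 : chambersOf (midHyperplaneUnion m) =
      connectedComponentIn (midHyperplaneUnion m)ᶜ '' (midHyperplaneUnion m)ᶜ := by
    ext C
    exact exists_congr fun x => and_congr_right fun _ => eq_comm
  have h2 : midpointOrder '' (midHyperplaneUnion m)ᶜ =
      (fun p : Equiv.Perm (Fin m) × (Fin m → ℝ) => midpointOrder (p.2 ∘ p.1)) ''
        (Set.univ ×ˢ (C0 m \ midUnion m)) := by
    ext P
    constructor
    · rintro ⟨x, hx, rfl⟩
      obtain ⟨σ, hσ⟩ := exists_strictMono_comp_perm (mem_generic_iff.1 hx).1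
      refine ⟨(σ.symm, x ∘ σ), ⟨Set.mem_univ _, ?_⟩, by simp [Function.comp_assoc]⟩
      exact mem_C0_diff_iff.2 ⟨hσ, generic_comp_perm hx σ⟩
    · rintro ⟨⟨σ, x⟩, ⟨-, hx⟩, rfl⟩
      exact ⟨x ∘ σ, generic_comp_perm (mem_C0_diff_iff.1 hx).2 σ, rfl⟩
  rw [h1, Set.ncard_image_eq_ncard_image fun x hx y hy => connectedComponentIn_eq_iff hm hx hy,
    h2, Set.ncard_image_eq_ncard_image (g := Prod.map id RPUF), Set.prodMap_image_prod,
    Set.ncard_prod, Set.image_id, Set.ncard_univ, Nat.card_perm, Nat.card_fin, r0_eq_ncard_image]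
  rintro ⟨σ, x⟩ ⟨-, hx⟩ ⟨τ, y⟩ ⟨-, hy⟩
  rw [midpointOrder_comp_eq_iff hm hx.1 hy.1, ← RPUF_eq_iff hm hx.1 hy.1]
  simp

end

/-- Theorem: `r_IE(3) = 1`, and for `m ≥ 4`,
`r_IE(m) = r_0(m)/2 = |ch(M_m)|/(2·m!)` (stated multiplicatively). -/
theorem number_of_inequivalent_ranking_patterns :
    rIE 3 = 1 ∧
    ∀ m : ℕ, 4 ≤ m →
      2 * rIE m = r0 m ∧
      2 * Nat.factorial m * rIE m = (chambersOf (midHyperplaneUnion m)).ncard := by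
  refine ⟨rIE_three, fun m hm => ⟨(r0_eq_two_mul_rIE hm).symm, ?_⟩⟩
  rw [ncard_chambersOf (by omega), r0_eq_two_mul_rIE hm]
  ring
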